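/- arXiv:2008.06862 — 5 statements merged into one kernel-verified Lean document; each statement's English description precedes it below -/
import Mathlib

section
/- Let λ₁, λ₂, λ₃, λ₄ be real numbers with arctan λ₁ + arctan λ₂ + arctan λ₃ + arctan λ₄ ∈ (π, 3π/2). Then σ₂ − σ₄ − 1 > 0, where σ₂ = Σ_{i<j} λᵢλⱼ and σ₄ = λ₁λ₂λ₃λ₄. -/
open Real

theorem sin_arctan_eq_mul_cos_arctan (x : ℝ) : sin (arctan x) = x * cos (arctan x) := by
  rw [← tan_mul_cos (cos_arctan_pos x).ne', tan_arctan]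

/-- The real part of `∏ (1 + i lⱼ)`, normalised by the moduli of the factors. -/
theorem cos_arctan_add_arctan_add_arctan_add_arctan (l₁ l₂ l₃ l₄ : ℝ) :
    cos (arctan l₁ + arctan l₂ + arctan l₃ + arctan l₄) =
      cos (arctan l₁) * cos (arctan l₂) * cos (arctan l₃) * cos (arctan l₄) *
        (1 - (l₁ * l₂ + l₁ * l₃ + l₁ * l₄ + l₂ * l₃ + l₂ * l₄ + l₃ * l₄) +
          l₁ * l₂ * l₃ * l₄) := by
  simp only [cos_add, sin_add, sin_arctan_eq_mul_cos_arctan]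
  ring

theorem stmt_5 (l₁ l₂ l₃ l₄ : ℝ)
    (h : arctan l₁ + arctan l₂ + arctan l₃ + arctan l₄ ∈
      Set.Ioo π (3 * π / 2)) :
    (l₁ * l₂ + l₁ * l₃ + l₁ * l₄ + l₂ * l₃ + l₂ * l₄ + l₃ * l₄)
      - (l₁ * l₂ * l₃ * l₄) - 1 > 0 := by
  obtain ⟨hl, hu⟩ := h
  have hcos : cos (arctan l₁ + arctan l₂ + arctan l₃ + arctan l₄) < 0 :=
    cos_neg_of_pi_div_two_lt_of_lt (by linarith [pi_pos]) (by linarith)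
  rw [cos_arctan_add_arctan_add_arctan_add_arctan] at hcos
  have hpos : 0 < cos (arctan l₁) * cos (arctan l₂) * cos (arctan l₃) * cos (arctan l₄) :=
    mul_pos (mul_pos (mul_pos (cos_arctan_pos l₁) (cos_arctan_pos l₂)) (cos_arctan_pos l₃))
      (cos_arctan_pos l₄)
  linarith [(pos_iff_neg_of_mul_neg hcos).mp hpos]
end

section
/- Let λ₁, λ₂, λ₃, λ₄ be real numbers with arctan λ₁ + arctan λ₂ + arctan λ₃ + arctan λ₄ ∈ (π, 3π/2). Then σ₃ − σ₁ > 0, where σ₁ = λ₁+λ₂+λ₃+λ₄ and σ₃ = Σ_{i<j<k} λᵢλⱼλₖ. -/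
open Real

theorem sin_arctan_add_arctan_add_arctan_add_arctan (a b c d : ℝ) :
    sin (arctan a + arctan b + arctan c + arctan d) =
      cos (arctan a) * cos (arctan b) * cos (arctan c) * cos (arctan d) *
        ((a + b + c + d) - (a * b * c + a * b * d + a * c * d + b * c * d)) := by
  simp only [sin_add, cos_add, sin_arctan_eq_mul_cos_arctan]
  ring

theorem stmt_6 (l₁ l₂ l₃ l₄ : ℝ)
    (h : arctan l₁ + arctan l₂ + arctan l₃ + arctan l₄ ∈
      Set.Ioo π (3 * π / 2)) :
    (l₁ * l₂ * l₃ + l₁ * l₂ * l₄ + l₁ * l₃ * l₄ + l₂ * l₃ * l₄)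
      - (l₁ + l₂ + l₃ + l₄) > 0 := by
  obtain ⟨h₁, h₂⟩ := h
  have hsin : sin (arctan l₁ + arctan l₂ + arctan l₃ + arctan l₄) < 0 := by
    rw [← sin_sub_two_pi]
    exact sin_neg_of_neg_of_neg_pi_lt (by linarith [pi_pos]) (by linarith)
  rw [sin_arctan_add_arctan_add_arctan_add_arctan] at hsin
  have hcos : 0 < cos (arctan l₁) * cos (arctan l₂) * cos (arctan l₃) * cos (arctan l₄) :=
    mul_pos (mul_pos (mul_pos (cos_arctan_pos l₁) (cos_arctan_pos l₂)) (cos_arctan_pos l₃))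
      (cos_arctan_pos l₄)
  linarith [neg_of_mul_neg_right hsin hcos.le]
end

section
/- Let λ₁, λ₂, λ₃, λ₄ be real numbers with arctan λ₁ + arctan λ₂ + arctan λ₃ + arctan λ₄ ∈ (π, 3π/2). Then σ₃ − σ₁σ₂ + σ₁ < 0, where σ₁ = Σᵢ λᵢ, σ₂ = Σ_{i<j} λᵢλⱼ, and σ₃ = Σ_{i<j<k} λᵢλⱼλₖ. -/
open Real

lemma add_pos_of_arctan_add_pos {a b : ℝ} (h : 0 < arctan a + arctan b) : 0 < a + b := by
  have hlt : arctan (-b) < arctan a := by rw [arctan_neg]; linarith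
  linarith [arctan_strictMono.lt_iff_lt.1 hlt]

lemma one_lt_mul_of_pi_div_two_lt_arctan_add {a b : ℝ} (h : π / 2 < arctan a + arctan b) :
    1 < a * b := by
  have hb : 0 < b := arctan_pos.1 (by linarith [arctan_lt_pi_div_two a])
  have hlt : arctan b⁻¹ < arctan a := by rw [arctan_inv_of_pos hb]; linarith
  exact (inv_lt_iff_one_lt_mul₀ hb).1 (arctan_strictMono.lt_iff_lt.1 hlt)

/-- If all pairwise sums are positive and `a * b > 1`, then
`σ₁ * (σ₂ - a * b) - σ₃ = (c + d) * (σ₂ + a ^ 2 + b ^ 2)` is positive, and `σ₁ < σ₁ * (a * b)`. -/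
lemma esymm_combination_neg_of_one_lt_mul {a b c d : ℝ} (hab : 1 < a * b) (hs : 0 < a + b)
    (hac : 0 < a + c) (had : 0 < a + d) (hbc : 0 < b + c) (hbd : 0 < b + d) (hcd : 0 < c + d) :
    (a * b * c + a * b * d + a * c * d + b * c * d)
      - (a + b + c + d) * (a * b + a * c + a * d + b * c + b * d + c * d)
      + (a + b + c + d) < 0 := by
  have hb : 0 < b := by
    by_contra! hb
    nlinarith
  have ha : 0 < a := pos_of_mul_pos_left (by linarith) hb.le
  have hσ₂ : 0 < a * b + a * c + a * d + b * c + b * d + c * d := by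
    have hbcd : 0 < b * (c + d) := mul_pos hb hcd
    rcases le_total 0 c with hc | hc
    · linarith [mul_nonneg hc had.le, mul_pos ha hbd]
    · linarith [mul_nonneg (by linarith : 0 ≤ d) hac.le, mul_pos ha hbc]
  have hprod : 0 < (c + d) * (a * b + a * c + a * d + b * c + b * d + c * d + a ^ 2 + b ^ 2) := by
    positivity
  have hσ₁ : 0 < (a + b + c + d) * (a * b - 1) := mul_pos (by linarith) (by linarith)
  linarith

theorem stmt_8 (l₁ l₂ l₃ l₄ : ℝ)
    (h : arctan l₁ + arctan l₂ + arctan l₃ + arctan l₄ ∈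
      Set.Ioo π (3 * π / 2)) :
    (l₁ * l₂ * l₃ + l₁ * l₂ * l₄ + l₁ * l₃ * l₄ + l₂ * l₃ * l₄)
      - (l₁ + l₂ + l₃ + l₄) *
        (l₁ * l₂ + l₁ * l₃ + l₁ * l₄ + l₂ * l₃ + l₂ * l₄ + l₃ * l₄)
      + (l₁ + l₂ + l₃ + l₄) < 0 := by
  have hsum := h.1
  have h₁ := arctan_lt_pi_div_two l₁
  have h₂ := arctan_lt_pi_div_two l₂
  have h₃ := arctan_lt_pi_div_two l₃
  have h₄ := arctan_lt_pi_div_two l₄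
  have h₁₂ : 0 < l₁ + l₂ := add_pos_of_arctan_add_pos (by linarith)
  have h₁₃ : 0 < l₁ + l₃ := add_pos_of_arctan_add_pos (by linarith)
  have h₁₄ : 0 < l₁ + l₄ := add_pos_of_arctan_add_pos (by linarith)
  have h₂₃ : 0 < l₂ + l₃ := add_pos_of_arctan_add_pos (by linarith)
  have h₂₄ : 0 < l₂ + l₄ := add_pos_of_arctan_add_pos (by linarith)
  have h₃₄ : 0 < l₃ + l₄ := add_pos_of_arctan_add_pos (by linarith)
  rcases lt_or_ge (π / 2) (arctan l₁ + arctan l₂) with hlt | hge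
  · exact esymm_combination_neg_of_one_lt_mul
      (one_lt_mul_of_pi_div_two_lt_arctan_add hlt) h₁₂ h₁₃ h₁₄ h₂₃ h₂₄ h₃₄
  · have hlt : π / 2 < arctan l₃ + arctan l₄ := by linarith
    have := esymm_combination_neg_of_one_lt_mul (one_lt_mul_of_pi_div_two_lt_arctan_add hlt)
      h₃₄ (add_comm l₁ l₃ ▸ h₁₃) (add_comm l₂ l₃ ▸ h₂₃) (add_comm l₁ l₄ ▸ h₁₄)
      (add_comm l₂ l₄ ▸ h₂₄) h₁₂
    linarith
end

section
/- Let λ₁, λ₂, λ₃, λ₄ be real numbers with λ₁ < 0 < −λ₁ < λ₂ ≤ λ₃ ≤ λ₄ and λ₂·λ₄ > 1. Then σ₂ − 1 − σ₄ > 0, where σ₂ = Σ_{i<j} λᵢλⱼ and σ₄ = λ₁λ₂λ₃λ₄. -/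
theorem stmt_11 (l₁ l₂ l₃ l₄ : ℝ)
    (h1 : l₁ < 0) (h2 : -l₁ < l₂) (h23 : l₂ ≤ l₃) (h34 : l₃ ≤ l₄)
    (h24 : l₂ * l₄ > 1) :
    (l₁ * l₂ + l₁ * l₃ + l₁ * l₄ + l₂ * l₃ + l₂ * l₄ + l₃ * l₄)
      - 1 - (l₁ * l₂ * l₃ * l₄) > 0 := by
  have hsum : 0 < (l₁ + l₃) * (l₂ + l₄) := mul_pos (by linarith) (by linarith)
  have hprod : 0 < -l₁ * l₃ := mul_pos (by linarith) (by linarith)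
  have hrest : 0 < (l₂ * l₄ - 1) * (1 + -l₁ * l₃) := mul_pos (by linarith) (by linarith)
  linarith
end

section
/- Let λ₁, λ₂, λ₃ be real numbers with λ₁ ≤ 0 and arctan λ₁ + arctan λ₂ + arctan λ₃ ∈ (π/2, π). Then λ₁λ₂ + λ₂λ₃ + λ₁λ₃ > 1. -/
open Real

theorem cos_arctan_add_arctan_add_arctan (x y z : ℝ) :
    cos (arctan x + arctan y + arctan z) =
      cos (arctan x) * cos (arctan y) * cos (arctan z) * (1 - (x * y + y * z + x * z)) := by
  have hsin (t : ℝ) : sin (arctan t) = t * cos (arctan t) := by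
    rw [← tan_mul_cos (cos_arctan_pos t).ne', tan_arctan]
  rw [cos_add, cos_add, sin_add, hsin x, hsin y, hsin z]
  ring

theorem stmt_17 (l₁ l₂ l₃ : ℝ) (h1 : l₁ ≤ 0)
    (h : arctan l₁ + arctan l₂ + arctan l₃ ∈ Set.Ioo (π / 2) π) :
    l₁ * l₂ + l₂ * l₃ + l₁ * l₃ > 1 := by
  have hcos : cos (arctan l₁ + arctan l₂ + arctan l₃) < 0 :=
    cos_neg_of_pi_div_two_lt_of_lt h.1 (by linarith [h.2, pi_pos])
  rw [cos_arctan_add_arctan_add_arctan] at hcos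
  have hpos : 0 < cos (arctan l₁) * cos (arctan l₂) * cos (arctan l₃) :=
    mul_pos (mul_pos (cos_arctan_pos _) (cos_arctan_pos _)) (cos_arctan_pos _)
  linarith [neg_of_mul_neg_right hcos hpos.le]
end
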